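/- Let A ∈ ℂ^{m×n} be a nonzero matrix, r_1,…,r_m ∈ ℂ^n the conjugate transposes of the m rows of A, r_j a row vector among r_1,…,r_m with the largest 2-norm, v ∈ ℂ^n a right singular vector corresponding to the largest singular value of A (i.e. v ≠ 0 and ‖Av‖_2 = ‖A‖_{2→2}‖v‖_2), and S = {v, r_1, …, r_m}. Then for all real numbers p, q ∈ [2, ∞): max_{x ∈ S, x ≠ 0} ‖Ax‖_q/‖x‖_p ≥ n^{(2−p)/(2p)} · [ ‖Ar_j‖_q/(2‖Ar_j‖_∞) ]^{(q−2)/(2(q−1))} · [ ‖Av‖_q/‖Av‖_2 ]^{1/(q−1)} · ( min_{x ∈ S, x ≠ 0} ‖x‖_2/‖x‖_p ) · ‖A‖_{p→q}. -/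

import Mathlib

open scoped BigOperators

/-- The `ℓ_p` norm of a vector, for a real exponent `p`. -/
noncomputable def lpnorm {n : ℕ} {𝕜 : Type*} [RCLike 𝕜] (p : ℝ) (x : Fin n → 𝕜) : ℝ :=
  (∑ i, ‖x i‖ ^ p) ^ (1 / p)

/-- The `ℓ_∞` norm of a vector. -/
noncomputable def linorm {n : ℕ} {𝕜 : Type*} [RCLike 𝕜] (x : Fin n → 𝕜) : ℝ :=
  ⨆ i, ‖x i‖

/-- The `p → q` operator norm of a matrix: `max_{x ≠ 0} ‖Ax‖_q / ‖x‖_p`. -/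
noncomputable def opNorm {m n : ℕ} {𝕜 : Type*} [RCLike 𝕜] (p q : ℝ)
    (A : Matrix (Fin m) (Fin n) 𝕜) : ℝ :=
  ⨆ x : {x : Fin n → 𝕜 // x ≠ 0}, lpnorm q (A.mulVec x.1) / lpnorm p x.1

/-- The `p → ∞` operator norm of a matrix: `max_{x ≠ 0} ‖Ax‖_∞ / ‖x‖_p`. -/
noncomputable def opNormInf {m n : ℕ} {𝕜 : Type*} [RCLike 𝕜] (p : ℝ)
    (A : Matrix (Fin m) (Fin n) 𝕜) : ℝ :=
  ⨆ x : {x : Fin n → 𝕜 // x ≠ 0}, linorm (A.mulVec x.1) / lpnorm p x.1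

/-- `row A i` is the conjugate transpose of the `i`-th row of `A`,
so that `(A x) i = ⟨x, row A i⟩` for the standard Hermitian inner product. -/
def row {m n : ℕ} {𝕜 : Type*} [RCLike 𝕜] (A : Matrix (Fin m) (Fin n) 𝕜) (i : Fin m) :
    Fin n → 𝕜 := fun k => star (A i k)

/-- The standard Hermitian inner product `⟨x, y⟩ = ∑ k, x k * conj (y k)`. -/
noncomputable def hinner {n : ℕ} (x y : Fin n → ℂ) : ℂ := ∑ k, x k * star (y k)

theorem lpnorm_nonneg {n : ℕ} (p : ℝ) (x : Fin n → ℂ) : 0 ≤ lpnorm p x := by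
  unfold lpnorm; positivity

theorem lpnorm_rpow {n : ℕ} {p : ℝ} (hp : 0 < p) (x : Fin n → ℂ) :
    lpnorm p x ^ p = ∑ i, ‖x i‖ ^ p := by
  rw [lpnorm, one_div, Real.rpow_inv_rpow (by positivity) hp.ne']

theorem norm_apply_le_lpnorm {n : ℕ} {p : ℝ} (hp : 0 < p) (x : Fin n → ℂ) (i : Fin n) :
    ‖x i‖ ≤ lpnorm p x := by
  rw [← Real.rpow_le_rpow_iff (norm_nonneg _) (lpnorm_nonneg p x) hp, lpnorm_rpow hp]
  exact Finset.single_le_sum (f := fun i => ‖x i‖ ^ p) (fun _ _ => by positivity)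
    (Finset.mem_univ i)

theorem lpnorm_pos {n : ℕ} {p : ℝ} (hp : 0 < p) {x : Fin n → ℂ} (hx : x ≠ 0) :
    0 < lpnorm p x := by
  obtain ⟨i, hi⟩ := Function.ne_iff.mp hx
  exact (norm_pos_iff.mpr hi).trans_le (norm_apply_le_lpnorm hp x i)

theorem lpnorm_zero {n : ℕ} {p : ℝ} (hp : 0 < p) : lpnorm p (0 : Fin n → ℂ) = 0 := by
  simp [lpnorm, Real.zero_rpow hp.ne', Real.zero_rpow (inv_ne_zero hp.ne')]

theorem lpnorm_smul {n : ℕ} {p : ℝ} (hp : 0 < p) (a : ℂ) (x : Fin n → ℂ) :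
    lpnorm p (a • x) = ‖a‖ * lpnorm p x := by
  rw [← Real.rpow_left_inj (lpnorm_nonneg p _)
    (mul_nonneg (norm_nonneg a) (lpnorm_nonneg p x)) hp.ne',
    Real.mul_rpow (norm_nonneg a) (lpnorm_nonneg p x), lpnorm_rpow hp, lpnorm_rpow hp,
    Finset.mul_sum]
  exact Finset.sum_congr rfl fun i _ => by
    rw [Pi.smul_apply, smul_eq_mul, norm_mul, Real.mul_rpow (norm_nonneg _) (norm_nonneg _)]

theorem lpnorm_two_eq_norm {n : ℕ} (x : Fin n → ℂ) : lpnorm 2 x = ‖WithLp.toLp 2 x‖ := by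
  rw [EuclideanSpace.norm_eq, lpnorm, Real.sqrt_eq_rpow]
  simp

theorem continuous_lpnorm {n : ℕ} {p : ℝ} (hp : 0 < p) :
    Continuous (lpnorm p : (Fin n → ℂ) → ℝ) := by
  unfold lpnorm
  refine Continuous.rpow_const (continuous_finsetSum _ fun i _ =>
    Continuous.rpow_const (by fun_prop) fun _ => Or.inr hp.le) fun _ => Or.inr (by positivity)

theorem lpnorm_two_le {n : ℕ} {p : ℝ} (hp : 2 ≤ p) (x : Fin n → ℂ) :
    lpnorm 2 x ≤ (n : ℝ) ^ ((p - 2) / (2 * p)) * lpnorm p x := by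
  have hp0 : 0 < p := by linarith
  rw [← Real.rpow_le_rpow_iff (lpnorm_nonneg 2 x)
    (mul_nonneg (by positivity) (lpnorm_nonneg p x)) hp0,
    Real.mul_rpow (by positivity) (lpnorm_nonneg p x), lpnorm_rpow hp0, lpnorm,
    ← Real.rpow_mul (by positivity), ← Real.rpow_mul (by positivity)]
  have h := Real.rpow_sum_le_const_mul_sum_rpow Finset.univ (fun i => ‖x i‖ ^ (2 : ℝ))
    (p := p / 2) (by linarith)
  simp only [Finset.card_univ, Fintype.card_fin] at h
  convert h using 2
  · exact Finset.sum_congr rfl fun i _ => (abs_of_nonneg (by positivity)).symm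
  · ring
  · congr 1; field_simp
  · refine Finset.sum_congr rfl fun i _ => ?_
    rw [abs_of_nonneg (by positivity), ← Real.rpow_mul (norm_nonneg _)]
    congr 1; ring

/-- A matrix attains its `2 → q` operator norm on the unit sphere. -/
theorem exists_lpnorm_mulVec_maximizer {m n : ℕ} {q : ℝ} (hq : 0 < q)
    (A : Matrix (Fin m) (Fin n) ℂ) {v : Fin n → ℂ} (hv : v ≠ 0) :
    ∃ x : Fin n → ℂ, lpnorm 2 x = 1 ∧
      ∀ y, lpnorm q (A.mulVec y) ≤ lpnorm q (A.mulVec x) * lpnorm 2 y := by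
  have key : ∀ y : Fin n → ℂ, y ≠ 0 → lpnorm 2 (((lpnorm 2 y : ℂ))⁻¹ • y) = 1 := by
    intro y hy
    have hpos := lpnorm_pos two_pos hy
    rw [lpnorm_smul two_pos, norm_inv, Complex.norm_real, Real.norm_of_nonneg hpos.le,
      inv_mul_cancel₀ hpos.ne']
  have hne : (Metric.sphere (0 : EuclideanSpace ℂ (Fin n)) 1).Nonempty :=
    ⟨WithLp.toLp 2 (((lpnorm 2 v : ℂ))⁻¹ • v), by
      rw [mem_sphere_zero_iff_norm, ← lpnorm_two_eq_norm, key v hv]⟩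
  obtain ⟨x, hx, hmax⟩ := (isCompact_sphere (0 : EuclideanSpace ℂ (Fin n)) 1).exists_isMaxOn hne
    (f := fun x => lpnorm q (A.mulVec x.ofLp))
    ((continuous_lpnorm hq).comp (by fun_prop)).continuousOn
  refine ⟨x.ofLp, by simpa [lpnorm_two_eq_norm] using hx, fun y => ?_⟩
  rcases eq_or_ne y 0 with rfl | hy
  · simp [lpnorm_zero hq, lpnorm_zero two_pos]
  · have hpos := lpnorm_pos two_pos hy
    have h := hmax (a := WithLp.toLp 2 (((lpnorm 2 y : ℂ))⁻¹ • y)) (by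
      rw [mem_sphere_zero_iff_norm, ← lpnorm_two_eq_norm, key y hy])
    simp only [Set.mem_ofPred_eq, Matrix.mulVec_smul] at h
    rwa [lpnorm_smul hq, norm_inv, Complex.norm_real, Real.norm_of_nonneg hpos.le,
      inv_mul_le_iff₀ hpos, mul_comm] at h

theorem eq_smul_of_inner_eq {E : Type*} [NormedAddCommGroup E] [InnerProductSpace ℂ E]
    {u x : E} {C : ℝ} (hx : ‖x‖ = 1) (hu : ‖u‖ ≤ C) (h : inner ℂ u x = (C : ℂ)) :
    u = (C : ℂ) • x := by
  have hC : 0 ≤ C := (norm_nonneg u).trans hu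
  have h2 : ‖u - (C : ℂ) • x‖ ^ 2 = ‖u‖ ^ 2 - C ^ 2 := by
    rw [@norm_sub_sq ℂ, inner_smul_right, h, norm_smul, hx, Complex.norm_real,
      Real.norm_of_nonneg hC, ← Complex.ofReal_mul]
    change ‖u‖ ^ 2 - 2 * (C * C) + (C * 1) ^ 2 = _
    ring
  have h3 : ‖u - (C : ℂ) • x‖ ^ 2 ≤ 0 := by
    rw [h2]; nlinarith [norm_nonneg u]
  exact sub_eq_zero.mp (norm_eq_zero.mp (pow_eq_zero_iff two_ne_zero |>.mp
    (le_antisymm h3 (sq_nonneg _))))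

theorem inner_row {m n : ℕ} (A : Matrix (Fin m) (Fin n) ℂ) (i : Fin m) (x : Fin n → ℂ) :
    inner ℂ (WithLp.toLp 2 (row A i)) (WithLp.toLp 2 x) = A.mulVec x i := by
  simp [EuclideanSpace.inner_eq_star_dotProduct, row, Matrix.mulVec, dotProduct, mul_comm]

/-- Each coordinate of `A x`, for `x` a unit maximizer of `‖A x‖_q`, is bounded by the image of
the corresponding row. -/
theorem lpnorm_mul_norm_apply_le {m n : ℕ} {q : ℝ} (hq : 1 < q)
    (A : Matrix (Fin m) (Fin n) ℂ) {x : Fin n → ℂ} (hx : lpnorm 2 x = 1)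
    (hmax : ∀ y, lpnorm q (A.mulVec y) ≤ lpnorm q (A.mulVec x) * lpnorm 2 y) (i : Fin m) :
    lpnorm q (A.mulVec x) * ‖A.mulVec x i‖ ≤ lpnorm q (A.mulVec (row A i)) := by
  have hq0 : 0 < q := by linarith
  set z := A.mulVec x with hz
  set N := lpnorm q z with hN
  have hN0 : 0 ≤ N := lpnorm_nonneg q z
  rcases hN0.eq_or_lt with h0 | hNpos
  · rw [← h0, zero_mul]; exact lpnorm_nonneg q _
  set w : Fin m → ℂ := fun k => ((‖z k‖ ^ (q - 2) : ℝ) : ℂ) * z k with hw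
  have hwn : ∀ k, ‖w k‖ = ‖z k‖ ^ (q - 1) := by
    intro k
    rcases eq_or_ne (z k) 0 with h | h
    · simp [hw, h, Real.zero_rpow (by linarith : q - 1 ≠ 0)]
    · have := norm_pos_iff.mpr h
      rw [hw, norm_mul, Complex.norm_real, Real.norm_of_nonneg (by positivity),
        ← Real.rpow_add_one this.ne']
      congr 1; ring
  set u : EuclideanSpace ℂ (Fin n) := WithLp.toLp 2 (A.conjTranspose.mulVec w) with hu
  have hB : ∀ y, inner ℂ u (WithLp.toLp 2 y) = ∑ k, star (w k) * A.mulVec y k := by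
    intro y
    rw [hu, EuclideanSpace.inner_toLp_toLp, Matrix.star_mulVec, Matrix.conjTranspose_conjTranspose,
      dotProduct_comm, ← Matrix.dotProduct_mulVec]
    rfl
  have hBx : inner ℂ u (WithLp.toLp 2 x) = ((N ^ q : ℝ) : ℂ) := by
    rw [hB, hN, lpnorm_rpow hq0, Complex.ofReal_sum]
    refine Finset.sum_congr rfl fun k _ => ?_
    rw [← hz, hw]
    have : star (z k) * z k = ((‖z k‖ ^ 2 : ℝ) : ℂ) := by
      simpa using Complex.conj_mul' (z k)
    simp only [star_mul', Complex.star_def, Complex.conj_ofReal] at this ⊢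
    rw [mul_assoc, this, ← Complex.ofReal_mul]
    rcases eq_or_ne (z k) 0 with h | h
    · simp [h, Real.zero_rpow hq0.ne']
    · rw [← Real.rpow_natCast, ← Real.rpow_add (norm_pos_iff.mpr h)]
      norm_num
  have hBle : ∀ y, ‖inner ℂ u (WithLp.toLp 2 y)‖ ≤ N ^ (q - 1) * lpnorm q (A.mulVec y) := by
    intro y
    rw [hB]
    refine (norm_sum_le _ _).trans ?_
    have hpq : (q / (q - 1)).HolderConjugate q := (Real.HolderConjugate.conjExponent hq).symm
    have h := Real.inner_le_Lp_mul_Lq_of_nonneg Finset.univ hpq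
      (f := fun k => ‖w k‖) (g := fun k => ‖A.mulVec y k‖)
      (fun _ _ => norm_nonneg _) (fun _ _ => norm_nonneg _)
    have e : (∑ k, ‖w k‖ ^ (q / (q - 1))) ^ (1 / (q / (q - 1))) = N ^ (q - 1) := by
      have : ∀ k, ‖w k‖ ^ (q / (q - 1)) = ‖z k‖ ^ q := fun k => by
        rw [hwn, ← Real.rpow_mul (norm_nonneg _), mul_div_cancel₀ _ (by linarith)]
      simp only [this]
      rw [← lpnorm_rpow hq0, ← hN, ← Real.rpow_mul hN0]
      congr 1; field_simp
    rw [e] at h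
    simpa [lpnorm] using h
  have hNq : N ^ (q - 1) * N = N ^ q := by
    rw [← Real.rpow_add_one hNpos.ne']; congr 1; ring
  have hun : ‖u‖ ≤ N ^ q := by
    have h1 := (hBle u.ofLp).trans (mul_le_mul_of_nonneg_left (hmax u.ofLp) (by positivity))
    rw [← mul_assoc, hNq, lpnorm_two_eq_norm, WithLp.toLp_ofLp, inner_self_eq_norm_sq_to_K] at h1
    rcases (norm_nonneg u).eq_or_lt with h | h
    · rw [← h]; positivity
    · refine le_of_mul_le_mul_right ?_ h
      simpa [sq] using h1
  have hux := eq_smul_of_inner_eq (by rw [← lpnorm_two_eq_norm, hx]) hun hBx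
  have h1 := hBle (row A i)
  rw [hux, inner_smul_left, norm_mul, ← inner_conj_symm, inner_row, RCLike.norm_conj,
    RCLike.norm_conj, Complex.norm_real, Real.norm_of_nonneg (by positivity), ← hNq,
    mul_assoc] at h1
  exact le_of_mul_le_mul_left h1 (by positivity)

theorem lpnorm_mulVec_row_self {m n : ℕ} (A : Matrix (Fin m) (Fin n) ℂ) (j : Fin m) :
    ‖A.mulVec (row A j) j‖ = lpnorm 2 (row A j) ^ 2 := by
  rw [← inner_row, inner_self_eq_norm_sq_to_K, lpnorm_two_eq_norm]
  simp

theorem lpnorm_rpow_le_of_norm_apply_le {m : ℕ} {q B : ℝ} (hq : 2 ≤ q) {z : Fin m → ℂ}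
    (hz : ∀ i, ‖z i‖ ≤ B) : lpnorm q z ^ q ≤ B ^ (q - 2) * lpnorm 2 z ^ (2 : ℝ) := by
  rw [lpnorm_rpow (by linarith), lpnorm_rpow two_pos, Finset.mul_sum]
  refine Finset.sum_le_sum fun i _ => ?_
  rcases (norm_nonneg (z i)).eq_or_lt with h | h
  · rw [← h, Real.zero_rpow (by linarith), Real.zero_rpow two_ne_zero, mul_zero]
  · calc ‖z i‖ ^ q = ‖z i‖ ^ (q - 2) * ‖z i‖ ^ (2 : ℝ) := by
          rw [← Real.rpow_add h]; congr 1; ring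
      _ ≤ _ := by
          gcongr
          exact hz i

theorem lpnorm_mulVec_le_opNorm {m n : ℕ} (A : Matrix (Fin m) (Fin n) ℂ) (x : Fin n → ℂ) :
    lpnorm 2 (A.mulVec x) ≤ opNorm 2 2 A * lpnorm 2 x := by
  rcases eq_or_ne x 0 with rfl | hx
  · simp [lpnorm_zero two_pos]
  · obtain ⟨y, -, hy⟩ := exists_lpnorm_mulVec_maximizer two_pos A hx
    rw [← div_le_iff₀ (lpnorm_pos two_pos hx)]
    refine le_ciSup (f := fun x : {x : Fin n → ℂ // x ≠ 0} =>
      lpnorm 2 (A.mulVec x.1) / lpnorm 2 x.1) ⟨lpnorm 2 (A.mulVec y), ?_⟩ ⟨x, hx⟩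
    rintro _ ⟨t, rfl⟩
    exact (div_le_iff₀ (lpnorm_pos two_pos t.2)).mpr (hy t.1)

theorem opNorm_le {m n : ℕ} {p q N : ℝ} (hp : 2 ≤ p) (A : Matrix (Fin m) (Fin n) ℂ)
    (hN : 0 ≤ N) (h : ∀ y, lpnorm q (A.mulVec y) ≤ N * lpnorm 2 y) :
    opNorm p q A ≤ (n : ℝ) ^ ((p - 2) / (2 * p)) * N := by
  refine Real.iSup_le (fun x => ?_) (by positivity)
  rw [div_le_iff₀ (lpnorm_pos (by linarith) x.2)]
  calc _ ≤ N * lpnorm 2 x.1 := h x.1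
    _ ≤ N * ((n : ℝ) ^ ((p - 2) / (2 * p)) * lpnorm p x.1) :=
        mul_le_mul_of_nonneg_left (lpnorm_two_le hp _) hN
    _ = _ := by ring

theorem rpow_mul_rpow_mul_le {q N D R σ α β : ℝ} (hq : 2 ≤ q) (hN : 0 < N) (hD : 0 < D)
    (hR : 0 < R) (hσ : 0 < σ) (hα : 0 ≤ α) (hβ : 0 ≤ β) (hβR : β * R ≤ D) (hασ : α * σ ≤ D)
    (h : N ^ q ≤ (D * R / N) ^ (q - 2) * σ ^ (2 : ℝ)) :
    β ^ ((q - 2) / (2 * (q - 1))) * α ^ (1 / (q - 1)) * N ≤ D := by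
  have hq1 : 0 < q - 1 := by linarith
  have hq2 : 0 ≤ q - 2 := by linarith
  have hNle : N ≤ (D * R) ^ ((q - 2) / (2 * (q - 1))) * σ ^ (1 / (q - 1)) := by
    rw [← Real.rpow_le_rpow_iff hN.le (by positivity) (by linarith : 0 < 2 * (q - 1)),
      Real.mul_rpow (by positivity) (by positivity), ← Real.rpow_mul (by positivity),
      ← Real.rpow_mul hσ.le, div_mul_cancel₀ _ (by positivity),
      show 1 / (q - 1) * (2 * (q - 1)) = 2 by field_simp,
      show 2 * (q - 1) = q + (q - 2) by ring, Real.rpow_add hN]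
    rw [Real.div_rpow (by positivity) hN.le, div_mul_eq_mul_div,
      le_div_iff₀ (by positivity)] at h
    exact h
  calc _ ≤ (D / R) ^ ((q - 2) / (2 * (q - 1))) * (D / σ) ^ (1 / (q - 1)) *
        ((D * R) ^ ((q - 2) / (2 * (q - 1))) * σ ^ (1 / (q - 1))) := by
        gcongr
        · exact (le_div_iff₀ hR).mpr hβR
        · exact (le_div_iff₀ hσ).mpr hασ
    _ = ((D / R) * (D * R)) ^ ((q - 2) / (2 * (q - 1))) * ((D / σ) * σ) ^ (1 / (q - 1)) := by
        rw [Real.mul_rpow (x := D / R) (by positivity) (by positivity),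
          Real.mul_rpow (x := D / σ) (by positivity) hσ.le]
        ring
    _ = D := by
        rw [show D / R * (D * R) = D ^ (2 : ℝ) by
            rw [Real.rpow_two]; field_simp, div_mul_cancel₀ _ hσ.ne',
          ← Real.rpow_mul hD.le, ← Real.rpow_add hD]
        convert Real.rpow_one D using 2
        field_simp
        ring

theorem finite_setOf_ratio {n : ℕ} {s : Set (Fin n → ℂ)} (hs : s.Finite)
    (f : (Fin n → ℂ) → ℝ) : {t : ℝ | ∃ x ∈ s, x ≠ 0 ∧ t = f x}.Finite :=
  (hs.image f).subset (by rintro t ⟨x, hx, -, rfl⟩; exact ⟨x, hx, rfl⟩)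

theorem stmt5 {m n : ℕ} (p q : ℝ) (hp : 2 ≤ p) (hq : 2 ≤ q)
    (A : Matrix (Fin m) (Fin n) ℂ) (hA : A ≠ 0)
    (j : Fin m) (hj : ∀ i, lpnorm 2 (row A i) ≤ lpnorm 2 (row A j))
    (v : Fin n → ℂ) (hv : v ≠ 0)
    (hsv : lpnorm 2 (A.mulVec v) = opNorm 2 2 A * lpnorm 2 v)
    (M : ℝ)
    (hM : M = sSup {t : ℝ | ∃ x ∈ insert v (Set.range (row A)), x ≠ 0 ∧
      t = lpnorm q (A.mulVec x) / lpnorm p x})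
    (c : ℝ)
    (hc : c = sInf {t : ℝ | ∃ x ∈ insert v (Set.range (row A)), x ≠ 0 ∧
      t = lpnorm 2 x / lpnorm p x}) :
    M ≥ (n : ℝ) ^ ((2 - p) / (2 * p)) *
      ((lpnorm q (A.mulVec (row A j)) / (2 * linorm (A.mulVec (row A j)))) ^
          ((q - 2) / (2 * (q - 1))) *
        (lpnorm q (A.mulVec v) / lpnorm 2 (A.mulVec v)) ^ (1 / (q - 1)) * c) *
      opNorm p q A := by
  have hp0 : 0 < p := by linarith
  have hq0 : 0 < q := by linarith
  set S := insert v (Set.range (row A)) with hS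
  have hSfin : S.Finite := (Set.finite_range _).insert v
  have hvS : v ∈ S := Set.mem_insert _ _
  have hrS : ∀ i, row A i ∈ S := fun i => Set.mem_insert_of_mem _ ⟨i, rfl⟩
  have hMle : ∀ x ∈ S, x ≠ 0 → lpnorm q (A.mulVec x) ≤ M * lpnorm p x := fun x hx hx0 => by
    rw [← div_le_iff₀ (lpnorm_pos hp0 hx0), hM]
    exact le_csSup (finite_setOf_ratio hSfin _).bddAbove ⟨x, hx, hx0, rfl⟩
  have hcle : ∀ x ∈ S, x ≠ 0 → c * lpnorm p x ≤ lpnorm 2 x := fun x hx hx0 => by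
    rw [← le_div_iff₀ (lpnorm_pos hp0 hx0), hc]
    exact csInf_le (finite_setOf_ratio hSfin _).bddBelow ⟨x, hx, hx0, rfl⟩
  have hcpos : 0 < c := by
    have hne : {t : ℝ | ∃ x ∈ S, x ≠ 0 ∧ t = lpnorm 2 x / lpnorm p x}.Nonempty :=
      ⟨_, v, hvS, hv, rfl⟩
    obtain ⟨x, -, hx0, hx⟩ := hne.csInf_mem (finite_setOf_ratio hSfin _)
    rw [hc, hx]
    exact div_pos (lpnorm_pos two_pos hx0) (lpnorm_pos hp0 hx0)
  have hDle : ∀ x ∈ S, lpnorm q (A.mulVec x) ≤ M / c * lpnorm 2 x := fun x hx => by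
    rcases eq_or_ne x 0 with rfl | hx0
    · simp [lpnorm_zero hq0, lpnorm_zero two_pos]
    · have hp1 := lpnorm_pos hp0 hx0
      have hM0 : 0 ≤ M := nonneg_of_mul_nonneg_left
        ((lpnorm_nonneg q _).trans (hMle x hx hx0)) hp1
      rw [div_mul_eq_mul_div, le_div_iff₀ hcpos]
      nlinarith [mul_le_mul_of_nonneg_left (hcle x hx hx0) hM0,
        mul_le_mul_of_nonneg_right (hMle x hx hx0) hcpos.le]
  obtain ⟨x, hx1, hmax⟩ := exists_lpnorm_mulVec_maximizer hq0 A hv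
  set N := lpnorm q (A.mulVec x) with hN
  set R := lpnorm 2 (row A j) with hR
  set σ := opNorm 2 2 A with hσ
  have hRpos : 0 < R := by
    obtain ⟨i, hi⟩ := Function.ne_iff.mp hA
    obtain ⟨k, hk⟩ := Function.ne_iff.mp hi
    refine (lpnorm_pos two_pos fun h => hk ?_).trans_le (hj i)
    simpa [row] using congrFun h k
  have hArj : R ^ 2 ≤ linorm (A.mulVec (row A j)) := by
    rw [← lpnorm_mulVec_row_self]
    exact le_ciSup (f := fun i => ‖A.mulVec (row A j) i‖) (Set.finite_range _).bddAbove j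
  have hArjq : R ^ 2 ≤ lpnorm q (A.mulVec (row A j)) := by
    rw [← lpnorm_mulVec_row_self]
    exact norm_apply_le_lpnorm hq0 _ j
  have hNpos : 0 < N :=
    pos_of_mul_pos_left ((pow_pos hRpos 2).trans_le (hArjq.trans (hmax _))) hRpos.le
  have hDpos : 0 < M / c :=
    pos_of_mul_pos_left ((pow_pos hRpos 2).trans_le (hArjq.trans (hDle _ (hrS j)))) hRpos.le
  have hz2 : lpnorm 2 (A.mulVec x) ≤ σ := by
    simpa [hx1] using lpnorm_mulVec_le_opNorm A x
  have hσpos : 0 < σ := by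
    refine (lpnorm_pos two_pos fun h => hNpos.ne' ?_).trans_le hz2
    rw [hN, h, lpnorm_zero hq0]
  have hzi : ∀ i, ‖A.mulVec x i‖ ≤ M / c * R / N := fun i => by
    rw [le_div_iff₀ hNpos, mul_comm]
    exact (lpnorm_mul_norm_apply_le (by linarith) A hx1 hmax i).trans
      ((hDle _ (hrS i)).trans (mul_le_mul_of_nonneg_left (hj i) hDpos.le))
  have hNq : N ^ q ≤ (M / c * R / N) ^ (q - 2) * σ ^ (2 : ℝ) := by
    refine (lpnorm_rpow_le_of_norm_apply_le hq hzi).trans ?_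
    gcongr
    exact lpnorm_nonneg _ _
  have hli : 0 < linorm (A.mulVec (row A j)) := (pow_pos hRpos 2).trans_le hArj
  have hvpos := lpnorm_pos two_pos hv
  have hβR : lpnorm q (A.mulVec (row A j)) / (2 * linorm (A.mulVec (row A j))) * R ≤ M / c := by
    rw [div_mul_eq_mul_div, div_le_iff₀ (by positivity)]
    calc _ ≤ M / c * R * R := mul_le_mul_of_nonneg_right (hDle _ (hrS j)) hRpos.le
      _ = M / c * R ^ 2 := by ring
      _ ≤ M / c * (2 * linorm (A.mulVec (row A j))) :=
          mul_le_mul_of_nonneg_left (by linarith) hDpos.le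
  have hασ : lpnorm q (A.mulVec v) / lpnorm 2 (A.mulVec v) * σ ≤ M / c := by
    rw [hsv, div_mul_eq_mul_div, div_le_iff₀ (by positivity)]
    calc _ ≤ M / c * lpnorm 2 v * σ := mul_le_mul_of_nonneg_right (hDle _ hvS) hσpos.le
      _ = _ := by ring
  have hα0 : 0 ≤ lpnorm q (A.mulVec v) / lpnorm 2 (A.mulVec v) :=
    div_nonneg (lpnorm_nonneg _ _) (lpnorm_nonneg _ _)
  have hβ0 : 0 ≤ lpnorm q (A.mulVec (row A j)) / (2 * linorm (A.mulVec (row A j))) :=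
    div_nonneg (lpnorm_nonneg _ _) (by positivity)
  have hcore := rpow_mul_rpow_mul_le hq hNpos hDpos hRpos hσpos hα0 hβ0 hβR hασ hNq
  have hn : (0 : ℝ) < n := by
    obtain ⟨k, -⟩ := Function.ne_iff.mp hv
    exact_mod_cast k.pos
  have hop := opNorm_le hp A hNpos.le hmax
  rw [le_div_iff₀ hcpos] at hcore
  generalize lpnorm q (A.mulVec (row A j)) / (2 * linorm (A.mulVec (row A j))) = β at *
  generalize lpnorm q (A.mulVec v) / lpnorm 2 (A.mulVec v) = α at *
  calc _ ≤ (n : ℝ) ^ ((2 - p) / (2 * p)) *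
        (β ^ ((q - 2) / (2 * (q - 1))) * α ^ (1 / (q - 1)) * c) *
        ((n : ℝ) ^ ((p - 2) / (2 * p)) * N) := mul_le_mul_of_nonneg_left hop (by positivity)
    _ = (n : ℝ) ^ ((2 - p) / (2 * p) + (p - 2) / (2 * p)) *
        (β ^ ((q - 2) / (2 * (q - 1))) * α ^ (1 / (q - 1)) * N * c) := by
        rw [Real.rpow_add hn]; ring
    _ ≤ M := by
        rwa [show (2 - p) / (2 * p) + (p - 2) / (2 * p) = 0 by ring, Real.rpow_zero, one_mul]
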